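/- For ℓ_1 > 0, d_1 ≥ 0, ℓ_2 > 0, d_2 ≥ 0 and ξ ∈ ℝ, define G(ℓ_1, d_1, ℓ_2, d_2, ξ) = ∫_{−∞}^{min(ξ,0)} (2/ℓ_1)(d_1 − 2y) exp(2y(d_1 − y)/ℓ_1) · (1 − exp(2(y − ξ)(d_2 − (y − ξ))/ℓ_2)) dy. Then, with all other arguments held fixed, G is nondecreasing in ξ, nondecreasing in d_2, nondecreasing in ℓ_1, nonincreasing in d_1, and nonincreasing in ℓ_2. -/

import Mathlib

open MeasureTheory Real

/-- The probability `P{m(B₁) < m(B₂)}` that the minimum of a Brownian bridge of length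
`ℓ₁` and end-value gap `d₁` is lower than the minimum of an independent Brownian bridge
of length `ℓ₂`, end-value gap `d₂` and lower end-value offset `ξ` (formula (eq:pA1) of
the paper). -/
noncomputable def bridgeCompareProb (ℓ₁ d₁ ℓ₂ d₂ ξ : ℝ) : ℝ :=
  ∫ y in Set.Iio (min ξ 0),
    2 / ℓ₁ * (d₁ - 2 * y) * Real.exp (2 * y * (d₁ - y) / ℓ₁) *
      (1 - Real.exp (2 * (y - ξ) * (d₂ - (y - ξ)) / ℓ₂))

/-- Distribution function of the minimum. -/
noncomputable def bF (l d z : ℝ) : ℝ := Real.exp (2 * z * (d - z) / l)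
/-- Its derivative. -/
noncomputable def bf (l d z : ℝ) : ℝ := 2 / l * (d - 2 * z) * Real.exp (2 * z * (d - z) / l)

lemma bF_deriv (l d z : ℝ) : HasDerivAt (bF l d) (bf l d z) z := by
  have h : HasDerivAt (fun z : ℝ => 2 * z * (d - z) / l) (2 / l * (d - 2 * z)) z := by
    have h1 := (((hasDerivAt_id z).const_mul 2).mul ((hasDerivAt_id z).const_sub d)).div_const l
    refine HasDerivAt.congr_deriv h1 ?_
    simp only [id]
    ring
  have h2 := h.exp
  unfold bF bf
  convert h2 using 1
  ring

lemma bF_pos (l d z : ℝ) : 0 < bF l d z := Real.exp_pos _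

lemma bF_le_one {l d z : ℝ} (hl : 0 < l) (hd : 0 ≤ d) (hz : z ≤ 0) : bF l d z ≤ 1 := by
  unfold bF
  rw [Real.exp_le_one_iff]
  apply div_nonpos_of_nonpos_of_nonneg _ hl.le
  nlinarith

lemma bf_nonneg {l d z : ℝ} (hl : 0 < l) (hd : 0 ≤ d) (hz : z ≤ 0) : 0 ≤ bf l d z := by
  unfold bf
  have : 0 ≤ d - 2 * z := by linarith
  positivity

lemma bF_mono {l d z w : ℝ} (hl : 0 < l) (hd : 0 ≤ d) (hz : z ≤ w) (hw : w ≤ 0) :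
    bF l d z ≤ bF l d w := by
  unfold bF
  gcongr Real.exp (?_ / _)
  nlinarith

lemma bF_anti_d {l d d' z : ℝ} (hl : 0 < l) (hd : d ≤ d') (hz : z ≤ 0) :
    bF l d' z ≤ bF l d z := by
  unfold bF
  gcongr Real.exp (?_ / _)
  nlinarith

lemma bF_mono_l {l l' d z : ℝ} (hl : 0 < l) (hl' : l ≤ l') (hd : 0 ≤ d) (hz : z ≤ 0) :
    bF l d z ≤ bF l' d z := by
  unfold bF
  gcongr Real.exp ?_
  have h : 0 ≤ -(2 * z * (d - z)) := by nlinarith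
  have := div_le_div_of_nonneg_left h hl hl'
  rw [neg_div, neg_div] at this
  linarith

lemma bF_tendsto {l d : ℝ} (hl : 0 < l) (hd : 0 ≤ d) :
    Filter.Tendsto (bF l d) Filter.atBot (nhds 0) := by
  unfold bF
  apply Real.tendsto_exp_atBot.comp
  have h : Filter.Tendsto (fun z : ℝ => 2 / l * z) Filter.atBot Filter.atBot :=
    Filter.tendsto_id.const_mul_atBot (by positivity)
  refine Filter.tendsto_atBot_mono' _ ?_ h
  filter_upwards [Filter.eventually_le_atBot (-1 : ℝ)] with z hz
  rw [div_mul_eq_mul_div]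
  gcongr ?_ / _
  nlinarith

lemma bf_cont (l d : ℝ) : Continuous (bf l d) := by
  unfold bf
  fun_prop

lemma bF_cont (l d : ℝ) : Continuous (bF l d) := by
  unfold bF
  fun_prop

lemma bf_int {l d : ℝ} (hl : 0 < l) (hd : 0 ≤ d) : IntegrableOn (bf l d) (Set.Iic 0) := by
  have h : IntegrableOn (fun x => bf l d (-x)) (Set.Ioi 0) := by
    refine integrableOn_Ioi_deriv_of_nonneg' (g := fun x => - bF l d (-x)) (l := -0) ?_ ?_ ?_
    · intro x _
      have := ((bF_deriv l d (-x)).comp x (hasDerivAt_neg x)).neg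
      refine HasDerivAt.congr_deriv this ?_
      ring
    · intro x hx
      exact bf_nonneg hl hd (by simpa using (le_of_lt hx))
    · exact ((bF_tendsto hl hd).comp Filter.tendsto_neg_atTop_atBot).neg
  have h2 := (integrableOn_Ici_iff_integrableOn_Ioi (f := fun x => bf l d (-x))).mpr h
  have h3 := ((integrable_indicator_iff measurableSet_Ici).mpr h2).comp_neg
  rw [← integrable_indicator_iff measurableSet_Iic]
  refine h3.congr (Filter.Eventually.of_forall fun x => ?_)
  simp [Set.indicator]

lemma bG_eq (l d l2 d2 ξ : ℝ) : bridgeCompareProb l d l2 d2 ξ =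
    ∫ y in Set.Iic (min ξ 0), bf l d y * (1 - bF l2 d2 (y - ξ)) := by
  rw [integral_Iic_eq_integral_Iio]
  rfl

lemma bG_int {l d l2 d2 ξ : ℝ} (hl : 0 < l) (hd : 0 ≤ d) (hl2 : 0 < l2) (hd2 : 0 ≤ d2) :
    IntegrableOn (fun y => bf l d y * (1 - bF l2 d2 (y - ξ))) (Set.Iic (min ξ 0)) := by
  have h := (bf_int hl hd).mono_set (Set.Iic_subset_Iic.mpr (min_le_right ξ 0))
  refine Integrable.mono' h ?_ ?_
  · have h1 := bf_cont l d
    have h2 := bF_cont l2 d2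
    exact Continuous.aestronglyMeasurable (by fun_prop)
  · refine (ae_restrict_iff' measurableSet_Iic).mpr (Filter.Eventually.of_forall fun y hy => ?_)
    obtain ⟨hy1, hy2⟩ := le_min_iff.mp (Set.mem_Iic.mp hy)
    have h0 := bf_nonneg hl hd hy2
    have h1 := bF_le_one hl2 hd2 (sub_nonpos.mpr hy1)
    have h2 := bF_pos l2 d2 (y - ξ)
    rw [Real.norm_of_nonneg (mul_nonneg h0 (by linarith))]
    nlinarith

/-- Monotonicity in the first distribution function. -/
lemma bG_mono_first {l d l' d' l2 d2 ξ : ℝ} (hl : 0 < l) (hd : 0 ≤ d) (hl' : 0 < l')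
    (hd' : 0 ≤ d') (hl2 : 0 < l2) (hd2 : 0 ≤ d2) (hF : ∀ z ≤ 0, bF l d z ≤ bF l' d' z) :
    bridgeCompareProb l d l2 d2 ξ ≤ bridgeCompareProb l' d' l2 d2 ξ := by
  rw [bG_eq, bG_eq, ← sub_nonneg, ← integral_sub (bG_int hl' hd' hl2 hd2) (bG_int hl hd hl2 hd2)]
  set m := min ξ 0 with hm
  have hm1 : m ≤ ξ := min_le_left _ _
  have hm2 : m ≤ 0 := min_le_right _ _
  have hi2 : IntegrableOn (fun y => bf l2 d2 (y - ξ)) (Set.Iic m) := by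
    have h := ((bf_int hl2 hd2).integrable_indicator measurableSet_Iic).comp_sub_right ξ
    have h' := h.integrableOn (s := Set.Iic m)
    refine h'.congr_fun (fun y hy => ?_) measurableSet_Iic
    have : y - ξ ∈ Set.Iic (0 : ℝ) := by
      simp only [Set.mem_Iic] at hy ⊢
      linarith
    simp [Set.indicator_of_mem this]
  have hi3 : IntegrableOn (fun y => (bF l' d' y - bF l d y) * bf l2 d2 (y - ξ)) (Set.Iic m) := by
    refine Integrable.mono' hi2 ?_ ?_
    · have h1 := bf_cont l2 d2
      have h2 := bF_cont l d
      have h3 := bF_cont l' d'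
      exact Continuous.aestronglyMeasurable (by fun_prop)
    · refine (ae_restrict_iff' measurableSet_Iic).mpr (Filter.Eventually.of_forall fun y hy => ?_)
      have hy' : y ≤ m := hy
      have h0 := bf_nonneg hl2 hd2 (show y - ξ ≤ 0 by linarith)
      have h1 := bF_le_one hl' hd' (show y ≤ 0 by linarith)
      have h2 := bF_pos l d y
      have h3 := hF y (by linarith)
      rw [Real.norm_of_nonneg (mul_nonneg (by linarith) h0)]
      nlinarith
  have hi1 := (bG_int (ξ := ξ) hl' hd' hl2 hd2).sub (bG_int hl hd hl2 hd2)
  have key := integral_Iic_of_hasDerivAt_of_tendsto' (a := m) (m := (0 - 0) * (1 - 0))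
    (f := fun y => (bF l' d' y - bF l d y) * (1 - bF l2 d2 (y - ξ)))
    (f' := fun y => (bf l' d' y * (1 - bF l2 d2 (y - ξ)) - bf l d y * (1 - bF l2 d2 (y - ξ)))
      - (bF l' d' y - bF l d y) * bf l2 d2 (y - ξ)) ?_ (hi1.sub hi3) ?_
  · have e := integral_sub hi1 hi3
    simp only [Pi.sub_apply] at e
    rw [e] at key
    have p1 : 0 ≤ ∫ y in Set.Iic m, (bF l' d' y - bF l d y) * bf l2 d2 (y - ξ) := by
      refine setIntegral_nonneg measurableSet_Iic fun y hy => ?_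
      have hy' : y ≤ m := hy
      exact mul_nonneg (by linarith [hF y (by linarith)])
        (bf_nonneg hl2 hd2 (show y - ξ ≤ 0 by linarith))
    have p2 : 0 ≤ (bF l' d' m - bF l d m) * (1 - bF l2 d2 (m - ξ)) :=
      mul_nonneg (by linarith [hF m hm2])
        (by linarith [bF_le_one hl2 hd2 (show m - ξ ≤ 0 by linarith)])
    linarith
  · intro y _
    have h1 := (bF_deriv l' d' y).sub (bF_deriv l d y)
    have h2 : HasDerivAt (fun y => 1 - bF l2 d2 (y - ξ)) (-bf l2 d2 (y - ξ)) y :=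
      ((bF_deriv l2 d2 (y - ξ)).comp_sub_const y ξ).const_sub 1
    refine HasDerivAt.congr_deriv (h1.mul h2) ?_
    simp only [Pi.sub_apply]
    ring
  · have h1 := (bF_tendsto hl' hd').sub (bF_tendsto hl hd)
    have h2 : Filter.Tendsto (fun y => bF l2 d2 (y - ξ)) Filter.atBot (nhds 0) :=
      (bF_tendsto hl2 hd2).comp (Filter.tendsto_atBot_add_const_right _ (-ξ) Filter.tendsto_id)
    exact h1.mul (h2.const_sub 1)

/-- Monotonicity in the second distribution function. -/
lemma bG_mono_second {l d l2 d2 l2' d2' ξ : ℝ} (hl : 0 < l) (hd : 0 ≤ d) (hl2 : 0 < l2)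
    (hd2 : 0 ≤ d2) (hl2' : 0 < l2') (hd2' : 0 ≤ d2')
    (hF : ∀ z ≤ 0, bF l2' d2' z ≤ bF l2 d2 z) :
    bridgeCompareProb l d l2 d2 ξ ≤ bridgeCompareProb l d l2' d2' ξ := by
  rw [bG_eq, bG_eq]
  refine setIntegral_mono_on (bG_int hl hd hl2 hd2) (bG_int hl hd hl2' hd2') measurableSet_Iic
    fun y hy => ?_
  obtain ⟨hy1, hy2⟩ := le_min_iff.mp (Set.mem_Iic.mp hy)
  exact mul_le_mul_of_nonneg_left (by linarith [hF (y - ξ) (by linarith)]) (bf_nonneg hl hd hy2)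

lemma bG_mono_xi {l d l2 d2 ξ ξ' : ℝ} (hl : 0 < l) (hd : 0 ≤ d) (hl2 : 0 < l2)
    (hd2 : 0 ≤ d2) (h : ξ ≤ ξ') :
    bridgeCompareProb l d l2 d2 ξ ≤ bridgeCompareProb l d l2 d2 ξ' := by
  rw [bG_eq, bG_eq]
  have hs : Set.Iic (min ξ 0) ⊆ Set.Iic (min ξ' 0) :=
    Set.Iic_subset_Iic.mpr (min_le_min_right 0 h)
  have hi := bG_int (ξ := ξ') hl hd hl2 hd2
  refine (setIntegral_mono_on (bG_int hl hd hl2 hd2) (hi.mono_set hs) measurableSet_Iic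
    fun y hy => ?_).trans (setIntegral_mono_set hi ?_ hs.eventuallyLE)
  · obtain ⟨hy1, hy2⟩ := le_min_iff.mp (Set.mem_Iic.mp hy)
    have := bF_mono hl2 hd2 (show y - ξ' ≤ y - ξ by linarith) (by linarith)
    exact mul_le_mul_of_nonneg_left (by linarith) (bf_nonneg hl hd hy2)
  · refine (ae_restrict_iff' measurableSet_Iic).mpr (Filter.Eventually.of_forall fun y hy => ?_)
    obtain ⟨hy1, hy2⟩ := le_min_iff.mp (Set.mem_Iic.mp hy)
    exact mul_nonneg (bf_nonneg hl hd hy2)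
      (by linarith [bF_le_one hl2 hd2 (show y - ξ' ≤ 0 by linarith)])

/-- With all other arguments held fixed, `G = bridgeCompareProb` is
nondecreasing in `ξ`, nondecreasing in `d₂`, nondecreasing in `ℓ₁`, nonincreasing in
`d₁`, and nonincreasing in `ℓ₂` (on the domain `ℓ₁ > 0`, `d₁ ≥ 0`, `ℓ₂ > 0`, `d₂ ≥ 0`,
`ξ ∈ ℝ`). -/
theorem bridgeCompareProb_monotonicity :
    (∀ ℓ₁ d₁ ℓ₂ d₂ ξ ξ' : ℝ, 0 < ℓ₁ → 0 ≤ d₁ → 0 < ℓ₂ → 0 ≤ d₂ → ξ ≤ ξ' →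
      bridgeCompareProb ℓ₁ d₁ ℓ₂ d₂ ξ ≤ bridgeCompareProb ℓ₁ d₁ ℓ₂ d₂ ξ') ∧
    (∀ ℓ₁ d₁ ℓ₂ d₂ d₂' ξ : ℝ, 0 < ℓ₁ → 0 ≤ d₁ → 0 < ℓ₂ → 0 ≤ d₂ → d₂ ≤ d₂' →
      bridgeCompareProb ℓ₁ d₁ ℓ₂ d₂ ξ ≤ bridgeCompareProb ℓ₁ d₁ ℓ₂ d₂' ξ) ∧
    (∀ ℓ₁ ℓ₁' d₁ ℓ₂ d₂ ξ : ℝ, 0 < ℓ₁ → ℓ₁ ≤ ℓ₁' → 0 ≤ d₁ → 0 < ℓ₂ → 0 ≤ d₂ →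
      bridgeCompareProb ℓ₁ d₁ ℓ₂ d₂ ξ ≤ bridgeCompareProb ℓ₁' d₁ ℓ₂ d₂ ξ) ∧
    (∀ ℓ₁ d₁ d₁' ℓ₂ d₂ ξ : ℝ, 0 < ℓ₁ → 0 ≤ d₁ → d₁ ≤ d₁' → 0 < ℓ₂ → 0 ≤ d₂ →
      bridgeCompareProb ℓ₁ d₁' ℓ₂ d₂ ξ ≤ bridgeCompareProb ℓ₁ d₁ ℓ₂ d₂ ξ) ∧
    (∀ ℓ₁ d₁ ℓ₂ ℓ₂' d₂ ξ : ℝ, 0 < ℓ₁ → 0 ≤ d₁ → 0 < ℓ₂ → ℓ₂ ≤ ℓ₂' → 0 ≤ d₂ →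
      bridgeCompareProb ℓ₁ d₁ ℓ₂' d₂ ξ ≤ bridgeCompareProb ℓ₁ d₁ ℓ₂ d₂ ξ) := by
  refine ⟨?_, ?_, ?_, ?_, ?_⟩
  · intro ℓ₁ d₁ ℓ₂ d₂ ξ ξ' h1 h2 h3 h4 h5
    exact bG_mono_xi h1 h2 h3 h4 h5
  · intro ℓ₁ d₁ ℓ₂ d₂ d₂' ξ h1 h2 h3 h4 h5
    exact bG_mono_second h1 h2 h3 h4 h3 (h4.trans h5) fun z hz => bF_anti_d h3 h5 hz
  · intro ℓ₁ ℓ₁' d₁ ℓ₂ d₂ ξ h1 h2 h3 h4 h5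
    exact bG_mono_first h1 h3 (h1.trans_le h2) h3 h4 h5 fun z hz => bF_mono_l h1 h2 h3 hz
  · intro ℓ₁ d₁ d₁' ℓ₂ d₂ ξ h1 h2 h3 h4 h5
    exact bG_mono_first h1 (h2.trans h3) h1 h2 h4 h5 fun z hz => bF_anti_d h1 h3 hz
  · intro ℓ₁ d₁ ℓ₂ ℓ₂' d₂ ξ h1 h2 h3 h4 h5
    exact bG_mono_second h1 h2 (h3.trans_le h4) h5 h3 h5 fun z hz => bF_mono_l h3 h4 h5 hz
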